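/- Let T > L > 0, let n ≥ 1, let λ₁ < … < λ_n be positive lengths and −T < x₁ < … < x_{n−1} < 0, and suppose L + λ₁ + λ₂ + … + λ_n < T. Then for Lebesgue-almost every such (x₁,…,x_{n−1}; λ₁,…,λ_n), the total count Ñ(−T, x₁,…,x_{n−1}; L, λ₁,…,λ_n) := Σ_{π ∈ S_n} Ñ_π(−T, x₁,…,x_{n−1}; L, λ₁,…,λ_n) equals n!. -/

import Mathlib

open MeasureTheory

/-- Extend a `Fin n`-tuple of reals to `ℕ` by zero (junk values beyond `n`). -/
noncomputable def natExt {n : ℕ} (f : Fin n → ℝ) : ℕ → ℝ :=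
  fun k => if h : k < n then f ⟨k, h⟩ else 0

/-- The Lindley recursion: `z 0 = w 0`, `z (k+1) = max (z k + l k) (w (k+1))`. -/
noncomputable def lindleyNat (w l : ℕ → ℝ) : ℕ → ℝ
  | 0 => w 0
  | k + 1 => max (lindleyNat w l k + l k) (w (k + 1))

/-- Left ends of the r-configuration obtained by resolving conflicts of the sorted
configuration with left ends `w` and lengths `l`. -/
noncomputable def resolve {n : ℕ} (w l : Fin n → ℝ) : Fin n → ℝ :=
  fun i => lindleyNat (natExt w) (natExt l) i

/-- `IsXHit p l m` : placing rods of lengths `l i` with left ends `p i` and resolving the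
conflicts (after sorting the left ends), the resulting r-configuration has a hit of the
origin whose cluster is rooted at the rod originally placed at index `m`. -/
def IsXHit {n : ℕ} (p l : Fin n → ℝ) (m : Fin n) : Prop :=
  ∃ k r : Fin n, r ≤ k ∧
    resolve (p ∘ Tuple.sort p) (l ∘ Tuple.sort p) k + (l ∘ Tuple.sort p) k = 0 ∧
    resolve (p ∘ Tuple.sort p) (l ∘ Tuple.sort p) r = (p ∘ Tuple.sort p) r ∧
    (∀ i : Fin n, r < i → i ≤ k →
      resolve (p ∘ Tuple.sort p) (l ∘ Tuple.sort p) i ≠ (p ∘ Tuple.sort p) i) ∧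
    Tuple.sort p r = m

/-- Combinatorial form of a hit: the free rod sits at position `q` among the non-blocking rods,
the hit is made by the rod at position `c`, `e` lists the fixed left ends (blocking rod first,
origin last) and `l` the lengths in left-to-right order. -/
def IsHitPosition (e l : ℕ → ℝ) (q c : ℕ) : Prop :=
  q ≤ c ∧ e q + ∑ v ∈ Finset.Icc q c, l v < 0 ∧ 0 < e (q + 1) + ∑ v ∈ Finset.Icc q c, l v ∧
    (∀ u < q, e (u + 1) + ∑ v ∈ Finset.Icc u c, l v < 0) ∧
    ∀ u, q < u → u ≤ c → e u + ∑ v ∈ Finset.Icc u c, l v < 0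

theorem sum_Ico_add_sum_Icc (l : ℕ → ℝ) {m i k : ℕ} (h₁ : m ≤ i) (h₂ : i ≤ k) :
    ∑ v ∈ Finset.Ico m i, l v + ∑ v ∈ Finset.Icc i k, l v = ∑ v ∈ Finset.Icc m k, l v := by
  have h (a : ℕ) : Finset.Icc a k = Finset.Ico a (k + 1) := by ext; simp
  rw [h, h, Finset.sum_Ico_consecutive _ h₁ (by omega)]

theorem add_sum_Ico_le_lindleyNat (w l : ℕ → ℝ) {m i : ℕ} (h : m ≤ i) :
    w m + ∑ v ∈ Finset.Ico m i, l v ≤ lindleyNat w l i := by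
  induction i, h using Nat.le_induction with
  | base =>
    cases m with
    | zero => simp [lindleyNat]
    | succ m => simp [lindleyNat]
  | succ i h ih =>
    rw [Finset.sum_Ico_succ_top h, lindleyNat]
    exact le_max_of_le_left (by linarith)

theorem exists_lindleyNat_eq (w l : ℕ → ℝ) (i : ℕ) :
    ∃ m ≤ i, lindleyNat w l i = w m + ∑ v ∈ Finset.Ico m i, l v := by
  induction i with
  | zero => exact ⟨0, le_rfl, by simp [lindleyNat]⟩
  | succ i ih =>
    obtain ⟨m, hm, h⟩ := ih
    rcases max_choice (lindleyNat w l i + l i) (w (i + 1)) with h' | h'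
    · exact ⟨m, by omega, by rw [lindleyNat, h', h, Finset.sum_Ico_succ_top hm]; ring⟩
    · exact ⟨i + 1, le_rfl, by rw [lindleyNat, h']; simp⟩

theorem lindley_hit_iff (w l : ℕ → ℝ) {r k : ℕ} (hrk : r ≤ k) :
    (lindleyNat w l k + l k = 0 ∧ lindleyNat w l r = w r ∧
      ∀ i, r < i → i ≤ k → lindleyNat w l i ≠ w i) ↔
    (w r + ∑ v ∈ Finset.Icc r k, l v = 0 ∧
      (∀ m < r, w m + ∑ v ∈ Finset.Icc m k, l v ≤ 0) ∧
      ∀ m, r < m → m ≤ k → w m + ∑ v ∈ Finset.Icc m k, l v < 0) := by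
  constructor
  · rintro ⟨hk, hr, hne⟩
    have hz : ∀ i, r ≤ i → i ≤ k → lindleyNat w l i = w r + ∑ v ∈ Finset.Ico r i, l v := by
      intro i hi
      induction i, hi using Nat.le_induction with
      | base => simp [hr]
      | succ i hi ih =>
        intro hik
        have h := hne (i + 1) (by omega) hik
        rw [lindleyNat] at h ⊢
        rw [Finset.sum_Ico_succ_top hi, ← add_assoc, ← ih (by omega)]
        exact (max_choice _ _).resolve_right h
    have htot : w r + ∑ v ∈ Finset.Icc r k, l v = 0 := by
      rw [← sum_Ico_add_sum_Icc l hrk le_rfl, ← add_assoc, ← hz k hrk le_rfl]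
      simpa using hk
    refine ⟨htot, fun m hm => ?_, fun m hm hmk => ?_⟩
    · have h := add_sum_Ico_le_lindleyNat w l hm.le
      rw [hr] at h
      rw [← sum_Ico_add_sum_Icc l hm.le hrk]
      linarith
    · have h := add_sum_Ico_le_lindleyNat w l (le_refl m)
      have h' := lt_of_le_of_ne (by simpa using h) (hne m hm hmk).symm
      rw [hz m hm.le hmk] at h'
      rw [← sum_Ico_add_sum_Icc l hm.le hmk] at htot
      linarith
  · rintro ⟨htot, hlt, hgt⟩
    have hr : lindleyNat w l r = w r := by
      refine le_antisymm ?_ (by simpa using add_sum_Ico_le_lindleyNat w l (le_refl r))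
      obtain ⟨m, hm, h⟩ := exists_lindleyNat_eq w l r
      rw [h]
      rcases hm.eq_or_lt with rfl | hm'
      · simp
      · have h' := hlt m hm'
        rw [← sum_Ico_add_sum_Icc l hm hrk] at h'
        linarith
    have hz : ∀ i, r ≤ i → i ≤ k → lindleyNat w l i = w r + ∑ v ∈ Finset.Ico r i, l v := by
      intro i hi
      induction i, hi using Nat.le_induction with
      | base => simp [hr]
      | succ i hi ih =>
        intro hik
        have h := hgt (i + 1) (by omega) hik
        rw [← sum_Ico_add_sum_Icc l (show r ≤ i + 1 by omega) hik,
          Finset.sum_Ico_succ_top hi] at htot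
        rw [lindleyNat, Finset.sum_Ico_succ_top hi, ih (by omega), max_eq_left (by linarith)]
        ring
    refine ⟨?_, hr, fun i hi hik => ?_⟩
    · rw [hz k hrk le_rfl]
      rw [← sum_Ico_add_sum_Icc l hrk le_rfl] at htot
      simp at htot
      linarith
    · have h := hgt i hi hik
      rw [← sum_Ico_add_sum_Icc l hi.le hik] at htot
      rw [hz i hi.le hik]
      exact ne_of_gt (by linarith)

theorem sum_Icc_reflect (f : ℕ → ℝ) {u c : ℕ} (h : u ≤ c) :
    ∑ v ∈ Finset.Icc u c, f (c - v) = ∑ t ∈ Finset.range (c - u + 1), f t := by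
  refine Finset.sum_nbij' (fun v => c - v) (fun t => c - t) ?_ ?_ ?_ ?_ ?_ <;>
    simp <;> omega

/-- For a fixed arrangement of the lengths read leftwards from the hitting rod (partial sums `Q`),
some pair of positions produces a hit. -/
theorem exists_hit {n : ℕ} {e Q : ℕ → ℝ}
    (hend : e (n + 1) = 0) (hQ : 0 < Q 0) (hblock : ∀ t ≤ n, e 0 + Q t < 0)
    (hgen : ∀ j t, 0 < j → j ≤ n → t ≤ n → e j + Q t ≠ 0) :
    ∃ q c, c ≤ n ∧ (q ≤ c ∧ e q + Q (c - q) < 0 ∧ 0 < e (q + 1) + Q (c - q) ∧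
        (∀ u < q, e (u + 1) + Q (c - u) < 0) ∧ ∀ u, q < u → u ≤ c → e u + Q (c - u) < 0) := by
  classical
  have hA : ∃ c ≤ n, (∀ u ≤ c, e u + Q (c - u) < 0) ∧
      ∀ c', c < c' → c' ≤ n → ¬ ∀ u ≤ c', e u + Q (c' - u) < 0 := by
    refine ⟨Nat.findGreatest (fun c => ∀ u ≤ c, e u + Q (c - u) < 0) n,
      Nat.findGreatest_le _, ?_, fun c' h h' => Nat.findGreatest_is_greatest h h'⟩
    refine Nat.findGreatest_spec (P := fun c => ∀ u ≤ c, e u + Q (c - u) < 0) (Nat.zero_le n) ?_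
    intro u hu
    obtain rfl : u = 0 := by omega
    exact hblock 0 (Nat.zero_le n)
  obtain ⟨c, hcn, hA, hmax⟩ := hA
  have hB : ∃ u, u ≤ c ∧ 0 < e (u + 1) + Q (c - u) := by
    by_contra! hB
    rcases hcn.eq_or_lt with rfl | hlt
    · have := hB c le_rfl
      rw [hend, Nat.sub_self] at this
      linarith
    · refine hmax (c + 1) (by omega) (by omega) fun u hu => ?_
      rcases Nat.eq_zero_or_pos u with rfl | hu0
      · exact hblock _ (by omega)
      · obtain ⟨u, rfl⟩ : ∃ v, u = v + 1 := ⟨u - 1, by omega⟩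
        rw [show c + 1 - (u + 1) = c - u by omega]
        exact lt_of_le_of_ne (hB u (by omega)) (hgen _ _ (by omega) (by omega) (by omega))
  obtain ⟨hqc, hq⟩ := Nat.find_spec hB
  refine ⟨Nat.find hB, c, hcn, hqc, hA _ hqc, hq, fun u hu => ?_, fun u _ huc => hA u huc⟩
  have h := Nat.find_min hB hu
  have h' : e (u + 1) + Q (c - u) ≤ 0 := by
    by_contra! h'
    exact h ⟨by omega, h'⟩
  exact lt_of_le_of_ne h' (hgen _ _ (by omega) (by omega) (by omega))

theorem hit_unique {n : ℕ} {e Q : ℕ → ℝ} (he : ∀ i j, i < j → j ≤ n + 1 → e i < e j)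
    {q c q' c' : ℕ} (hcn : c ≤ n) (hcn' : c' ≤ n)
    (h : q ≤ c ∧ e q + Q (c - q) < 0 ∧ 0 < e (q + 1) + Q (c - q) ∧
        (∀ u < q, e (u + 1) + Q (c - u) < 0) ∧ ∀ u, q < u → u ≤ c → e u + Q (c - u) < 0)
    (h' : q' ≤ c' ∧ e q' + Q (c' - q') < 0 ∧ 0 < e (q' + 1) + Q (c' - q') ∧
        (∀ u < q', e (u + 1) + Q (c' - u) < 0) ∧
        ∀ u, q' < u → u ≤ c' → e u + Q (c' - u) < 0) : q = q' ∧ c = c' := by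
  have key : ∀ {q c q' c' : ℕ}, c ≤ n → c' ≤ n →
      (q ≤ c ∧ e q + Q (c - q) < 0 ∧ 0 < e (q + 1) + Q (c - q) ∧
        (∀ u < q, e (u + 1) + Q (c - u) < 0) ∧ ∀ u, q < u → u ≤ c → e u + Q (c - u) < 0) →
      (q' ≤ c' ∧ e q' + Q (c' - q') < 0 ∧ 0 < e (q' + 1) + Q (c' - q') ∧
        (∀ u < q', e (u + 1) + Q (c' - u) < 0) ∧
        ∀ u, q' < u → u ≤ c' → e u + Q (c' - u) < 0) → ¬ c < c' := by
    rintro q c q' c' hcn hcn' ⟨hqc, -, h1, -, -⟩ ⟨_, h2, _, h3, h4⟩ hlt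
    have hA : ∀ u ≤ c', e u + Q (c' - u) < 0 := by
      intro u hu
      rcases lt_trichotomy u q' with hu' | rfl | hu'
      · linarith [h3 u hu', he u (u + 1) (by omega) (by omega)]
      · exact h2
      · exact h4 u hu' hu
    have h5 := hA (q + 1 + (c' - (c + 1))) (by omega)
    rw [show c' - (q + 1 + (c' - (c + 1))) = c - q by omega] at h5
    rcases Nat.eq_zero_or_pos (c' - (c + 1)) with h0 | h0
    · rw [h0, add_zero] at h5
      linarith
    · linarith [he (q + 1) (q + 1 + (c' - (c + 1))) (by omega) (by omega)]
  obtain rfl : c = c' := by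
    have := key hcn hcn' h h'
    have := key hcn' hcn h' h
    omega
  refine ⟨?_, rfl⟩
  rcases lt_trichotomy q q' with hlt | heq | hlt
  · linarith [h.2.2.1, h'.2.2.2.1 q hlt]
  · exact heq
  · linarith [h'.2.2.1, h.2.2.2.1 q' hlt]

theorem natExt_val {n : ℕ} (f : Fin n → ℝ) (i : Fin n) : natExt f i = f i := by
  simp [natExt]

theorem natExt_of_lt {n : ℕ} (f : Fin n → ℝ) {i : ℕ} (h : i < n) : natExt f i = f ⟨i, h⟩ := by
  simp [natExt, h]

theorem natExt_cons_zero {n : ℕ} (a : ℝ) (f : Fin n → ℝ) :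
    natExt (Fin.cons a f : Fin (n + 1) → ℝ) 0 = a := by
  simp [natExt]

theorem natExt_cons_succ {n : ℕ} (a : ℝ) (f : Fin n → ℝ) (i : ℕ) :
    natExt (Fin.cons a f : Fin (n + 1) → ℝ) (i + 1) = natExt f i := by
  by_cases h : i < n
  · rw [natExt_of_lt _ h, natExt_of_lt _ (Nat.succ_lt_succ h)]
    exact Fin.cons_succ (α := fun _ => ℝ) a f ⟨i, h⟩
  · simp [natExt, h]

theorem sum_Icc_natExt {n : ℕ} (f : Fin n → ℝ) (u : ℕ) {c : ℕ} (h : c < n) :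
    ∑ v ∈ Finset.Icc u c, natExt f v = ∑ i ∈ Finset.univ.filter (fun i : Fin n => u ≤ (i : ℕ) ∧ (i : ℕ) ≤ c), f i := by
  have hI : Finset.Icc u c = (Finset.range n).filter fun v => u ≤ v ∧ v ≤ c := by
    ext; simp; omega
  rw [hI, Finset.sum_filter, Finset.sum_range, Finset.sum_filter]
  simp only [natExt_val]

theorem natExt_cons_strictMono {n : ℕ} {T : ℝ} {x : Fin n → ℝ} (hT : 0 < T) (hx : StrictMono x)
    (hmem : ∀ i, x i ∈ Set.Ioo (-T) 0) (i j : ℕ) (hij : i < j) (hj : j ≤ n + 1) :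
    natExt (Fin.cons (-T) x : Fin (n + 1) → ℝ) i < natExt (Fin.cons (-T) x : Fin (n + 1) → ℝ) j := by
  obtain ⟨j, rfl⟩ : ∃ k, j = k + 1 := ⟨j - 1, by omega⟩
  rw [natExt_cons_succ]
  cases i with
  | zero =>
    rw [natExt_cons_zero]
    by_cases hjn : j < n
    · rw [natExt_of_lt _ hjn]; exact (hmem _).1
    · simp [natExt, hjn, hT]
  | succ i =>
    have hi : i < n := by omega
    rw [natExt_cons_succ, natExt_of_lt _ hi]
    by_cases hjn : j < n
    · rw [natExt_of_lt _ hjn]; exact hx (by simpa using hij)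
    · simpa [natExt, hjn] using (hmem ⟨i, hi⟩).2

/-- The arrangement moving the last index to position `q`, keeping the order of the others. -/
def insertPerm {n : ℕ} (q : Fin (n + 1)) : Equiv.Perm (Fin (n + 1)) :=
  (finSuccEquiv' q).trans (finSuccEquiv' (Fin.last n)).symm

theorem insertPerm_self {n : ℕ} (q : Fin (n + 1)) : insertPerm q q = Fin.last n := by
  simp [insertPerm]

theorem insertPerm_succAbove {n : ℕ} (q : Fin (n + 1)) (j : Fin n) :
    insertPerm q (q.succAbove j) = j.castSucc := by
  simp [insertPerm]

theorem snoc_comp_insertPerm {n : ℕ} (q : Fin (n + 1)) (X : ℝ) (x : Fin n → ℝ) :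
    (Fin.snoc x X : Fin (n + 1) → ℝ) ∘ insertPerm q = q.insertNth X x := by
  ext i
  cases i using Fin.succAboveCases q with
  | x => simp [insertPerm_self]
  | p j => simp [insertPerm_succAbove]

theorem cons_comp_decomposeFin {n : ℕ} (a : ℝ) (f : Fin n → ℝ) (ρ : Equiv.Perm (Fin n)) :
    (Fin.cons a f : Fin (n + 1) → ℝ) ∘ Equiv.Perm.decomposeFin.symm (0, ρ) =
      Fin.cons a (f ∘ ρ) := by
  ext i
  cases i using Fin.cases <;> simp

theorem natExt_insertNth_of_lt {n : ℕ} (q : Fin (n + 1)) (X : ℝ) (x : Fin n → ℝ) {u : ℕ}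
    (h : u < q) : natExt (q.insertNth X x : Fin (n + 1) → ℝ) u = natExt x u := by
  have hu : u < n := by omega
  rw [natExt_of_lt _ (show u < n + 1 by omega), natExt_of_lt _ hu]
  have h' : (⟨u, by omega⟩ : Fin (n + 1)) = q.succAbove ⟨u, hu⟩ := by
    rw [Fin.succAbove_of_castSucc_lt _ _ (by simpa [Fin.lt_def] using h)]; rfl
  rw [h', Fin.insertNth_apply_succAbove]

theorem natExt_insertNth_self {n : ℕ} (q : Fin (n + 1)) (X : ℝ) (x : Fin n → ℝ) :
    natExt (q.insertNth X x : Fin (n + 1) → ℝ) q = X := by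
  rw [natExt_val, Fin.insertNth_apply_same]

theorem natExt_insertNth_succ {n : ℕ} (q : Fin (n + 1)) (X : ℝ) (x : Fin n → ℝ) {u : ℕ}
    (h : q ≤ u) : natExt (q.insertNth X x : Fin (n + 1) → ℝ) (u + 1) = natExt x u := by
  by_cases hu : u < n
  · rw [natExt_of_lt _ (show u + 1 < n + 1 by omega), natExt_of_lt _ hu]
    have h' : (⟨u + 1, by omega⟩ : Fin (n + 1)) = q.succAbove ⟨u, hu⟩ := by
      rw [Fin.succAbove_of_le_castSucc _ _ (by simpa [Fin.le_def] using h)]; rfl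
    rw [h', Fin.insertNth_apply_succAbove]
  · simp [natExt, hu]

theorem sum_Icc_succ_natExt_cons {n : ℕ} (a : ℝ) (f : Fin n → ℝ) (u c : ℕ) :
    ∑ v ∈ Finset.Icc (u + 1) (c + 1), natExt (Fin.cons a f : Fin (n + 1) → ℝ) v =
      ∑ v ∈ Finset.Icc u c, natExt f v := by
  refine Finset.sum_nbij' (fun v => v - 1) (fun v => v + 1) ?_ ?_ ?_ ?_ ?_
  · simp; omega
  · simp
  · simp; omega
  · simp
  · intro v hv
    obtain ⟨v, rfl⟩ : ∃ w, v = w + 1 := ⟨v - 1, by simp at hv; omega⟩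
    simp [natExt_cons_succ]

theorem sort_cons_snoc {n : ℕ} {T X : ℝ} {x : Fin n → ℝ} (hT : 0 < T) (hx : StrictMono x)
    (hmem : ∀ i, x i ∈ Set.Ioo (-T) 0) (q : Fin (n + 1))
    (h₁ : natExt (Fin.cons (-T) x : Fin (n + 1) → ℝ) q < X)
    (h₂ : X < natExt (Fin.cons (-T) x : Fin (n + 1) → ℝ) (q + 1)) :
    Tuple.sort (Fin.cons (-T) (Fin.snoc x X) : Fin (n + 2) → ℝ) =
      Equiv.Perm.decomposeFin.symm (0, insertPerm q) := by
  have he := natExt_cons_strictMono hT hx hmem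
  have hmono : StrictMono ((Fin.cons (-T) (Fin.snoc x X) : Fin (n + 2) → ℝ) ∘
      Equiv.Perm.decomposeFin.symm (0, insertPerm q)) := by
    rw [cons_comp_decomposeFin, snoc_comp_insertPerm, Fin.strictMono_iff_lt_succ]
    intro i
    rw [← natExt_val (Fin.cons (-T) _) i.castSucc, ← natExt_val (Fin.cons (-T) _) i.succ,
      Fin.val_castSucc, Fin.val_succ, natExt_cons_succ]
    obtain ⟨i, hi⟩ := i
    dsimp only
    rcases lt_trichotomy i q with hiq | hiq | hiq
    · rw [natExt_insertNth_of_lt _ _ _ hiq, ← natExt_cons_succ (-T) x]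
      have h := he i (i + 1) (by omega) (by omega)
      cases i with
      | zero => simpa [natExt_cons_zero] using h
      | succ i =>
        rw [natExt_cons_succ, natExt_insertNth_of_lt _ _ _ (by omega), ← natExt_cons_succ (-T) x]
        exact h
    · subst hiq
      rw [natExt_insertNth_self]
      cases hq : (q : ℕ) with
      | zero => rw [hq] at h₁; simpa [natExt_cons_zero] using h₁
      | succ i =>
        rw [natExt_cons_succ, natExt_insertNth_of_lt _ _ _ (by omega), ← natExt_cons_succ (-T) x,
          ← hq]
        exact h₁
    · obtain ⟨i, rfl⟩ : ∃ j, i = j + 1 := ⟨i - 1, by omega⟩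
      rw [natExt_insertNth_succ _ _ _ (by omega), natExt_cons_succ, ← natExt_cons_succ (-T) x]
      rcases (show (q : ℕ) ≤ i by omega).eq_or_lt with hq | hq
      · rw [← hq, natExt_insertNth_self]; exact h₂
      · obtain ⟨i, rfl⟩ : ∃ j, i = j + 1 := ⟨i - 1, by omega⟩
        rw [natExt_insertNth_succ _ _ _ (by omega), ← natExt_cons_succ (-T) x]
        exact he _ _ (by omega) (by omega)
  refine (Tuple.eq_sort_iff.mpr ⟨hmono.monotone, fun i j hij h => ?_⟩).symm
  exact absurd h (hmono hij).ne

theorem sum_Icc_natExt_le {n : ℕ} {f : Fin n → ℝ} (hf : ∀ i, 0 < f i) (u : ℕ) {c : ℕ}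
    (h : c < n) : ∑ v ∈ Finset.Icc u c, natExt f v ≤ ∑ i, f i := by
  rw [sum_Icc_natExt f u h]
  exact Finset.sum_le_univ_sum_of_nonneg fun i => (hf i).le

/-- No fixed left end is at distance from the origin equal to a sum of available lengths. -/
def Generic {n m : ℕ} (x : Fin n → ℝ) (g : Fin m → ℝ) : Prop :=
  ∀ (i : Fin n) (A : Finset (Fin m)), x i + ∑ a ∈ A, g a ≠ 0

theorem Generic.comp_perm {n m : ℕ} {x : Fin n → ℝ} {g : Fin m → ℝ} (h : Generic x g)
    (σ : Equiv.Perm (Fin m)) : Generic x (g ∘ σ) := by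
  intro i A
  simpa [Finset.sum_map] using h i (A.map σ.toEmbedding)

theorem Generic.natExt_ne {n m : ℕ} {x : Fin n → ℝ} {g : Fin m → ℝ} (h : Generic x g) {i : ℕ}
    (hi : i < n) (u : ℕ) {c : ℕ} (hc : c < m) :
    natExt x i + ∑ v ∈ Finset.Icc u c, natExt g v ≠ 0 := by
  rw [sum_Icc_natExt g u hc, natExt_of_lt _ hi]
  exact h _ _

theorem isXHit_iff {n : ℕ} {T L X : ℝ} {x : Fin n → ℝ} {g : Fin (n + 1) → ℝ} (hT : 0 < T)
    (hx : StrictMono x) (hmem : ∀ i, x i ∈ Set.Ioo (-T) 0) (hg : ∀ i, 0 < g i)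
    (hsum : L + ∑ i, g i < T) (hgen : Generic x g) (q : Fin (n + 1))
    (h₁ : natExt (Fin.cons (-T) x : Fin (n + 1) → ℝ) q < X)
    (h₂ : X < natExt (Fin.cons (-T) x : Fin (n + 1) → ℝ) (q + 1)) :
    IsXHit (Fin.cons (-T) (Fin.snoc x X)) (Fin.cons L g) (Fin.last (n + 1)) ↔
      ∃ c : Fin (n + 1), IsHitPosition (natExt (Fin.cons (-T) x : Fin (n + 1) → ℝ))
        (natExt (g ∘ insertPerm q)) q c ∧
        -∑ v ∈ Finset.Icc (q : ℕ) c, natExt (g ∘ insertPerm q) v = X := by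
  set f := g ∘ insertPerm q with hf
  have hfgen : Generic x f := hgen.comp_perm _
  have hfsum : L + ∑ i, f i < T := by
    rw [hf]; simpa only [Function.comp_apply, Equiv.sum_comp (insertPerm q) g] using hsum
  have hfpos : ∀ i, 0 < f i := fun i => hg _
  set w : Fin (n + 2) → ℝ := Fin.cons (-T) (q.insertNth X x : Fin (n + 1) → ℝ) with hw
  set l : Fin (n + 2) → ℝ := Fin.cons L f with hl
  have hroot : ∀ r, Equiv.Perm.decomposeFin.symm (0, insertPerm q) r = Fin.last (n + 1) ↔
      r = q.succ := by
    intro r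
    rw [← Equiv.eq_symm_apply]
    have : q.succ = (Equiv.Perm.decomposeFin.symm (0, insertPerm q)).symm (Fin.last (n + 1)) := by
      rw [Equiv.eq_symm_apply]
      simp [insertPerm_self]
    rw [this]
  have hX : IsXHit (Fin.cons (-T) (Fin.snoc x X)) (Fin.cons L g) (Fin.last (n + 1)) ↔
      ∃ c : Fin (n + 1), q ≤ c ∧
        (lindleyNat (natExt w) (natExt l) (c + 1) + natExt l (c + 1) = 0 ∧
          lindleyNat (natExt w) (natExt l) (q + 1) = natExt w (q + 1) ∧
          ∀ i, (q : ℕ) + 1 < i → i ≤ c + 1 → lindleyNat (natExt w) (natExt l) i ≠ natExt w i) := by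
    rw [IsXHit, sort_cons_snoc hT hx hmem q h₁ h₂, cons_comp_decomposeFin,
      cons_comp_decomposeFin, snoc_comp_insertPerm]
    simp only [hroot, resolve, ← hf, ← hw, ← hl]
    constructor
    · rintro ⟨k, r, hrk, hk, hr, hne, rfl⟩
      cases k using Fin.cases with
      | zero => simp at hrk
      | succ c =>
        refine ⟨c, by simpa using hrk, ?_, ?_, fun i hi hic => ?_⟩
        · rw [← natExt_val l] at hk; exact hk
        · rw [← natExt_val w] at hr; exact hr
        · have hin : i < n + 2 := by omega
          have h := hne ⟨i, hin⟩ (by simpa [Fin.lt_def] using hi) (by simpa [Fin.le_def] using hic)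
          rw [← natExt_val w] at h; exact h
    · rintro ⟨c, hqc, hk, hr, hne⟩
      refine ⟨c.succ, q.succ, by simpa using hqc, ?_, ?_, fun i hi hic => ?_, rfl⟩
      · rw [← natExt_val l]; exact hk
      · rw [← natExt_val w]; exact hr
      · rw [← natExt_val w]
        exact hne i (by simpa [Fin.lt_def] using hi) (by simpa [Fin.le_def] using hic)
  rw [hX]
  refine exists_congr fun c => ?_
  have hc := c.isLt
  by_cases hqc : q ≤ c
  swap
  · simp only [hqc, false_and, IsHitPosition, Fin.val_fin_le]
  have hqc' : (q : ℕ) ≤ c := hqc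
  rw [lindley_hit_iff _ _ (by omega), IsHitPosition, sum_Icc_succ_natExt_cons, hw,
    natExt_cons_succ, natExt_insertNth_self]
  have hbelow : ∀ u < (q : ℕ), natExt (q.insertNth X x : Fin (n + 1) → ℝ) u =
      natExt (Fin.cons (-T) x : Fin (n + 1) → ℝ) (u + 1) := fun u hu => by
    rw [natExt_insertNth_of_lt _ _ _ hu, natExt_cons_succ]
  have habove : ∀ u, (q : ℕ) < u → natExt (q.insertNth X x : Fin (n + 1) → ℝ) u =
      natExt (Fin.cons (-T) x : Fin (n + 1) → ℝ) u := fun u hu => by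
    obtain ⟨u, rfl⟩ : ∃ j, u = j + 1 := ⟨u - 1, by omega⟩
    rw [natExt_insertNth_succ _ _ _ (by omega), natExt_cons_succ]
  constructor
  · rintro ⟨-, htot, hlt, hgt⟩
    refine ⟨⟨hqc', by linarith, by linarith, fun u hu => ?_, fun u hu huc => ?_⟩, by linarith⟩
    · have h := hlt (u + 1) (by omega)
      rw [natExt_cons_succ, sum_Icc_succ_natExt_cons, hbelow u hu, natExt_cons_succ] at h
      rw [natExt_cons_succ]
      exact lt_of_le_of_ne h (hfgen.natExt_ne (by omega) u hc)
    · have h := hgt (u + 1) (by omega) (by omega)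
      rwa [natExt_cons_succ, sum_Icc_succ_natExt_cons, habove u hu] at h
  · rintro ⟨⟨-, -, -, hlt, hgt⟩, htot⟩
    refine ⟨hqc, by linarith, fun m hm => ?_, fun m hm hmc => ?_⟩
    · cases m with
      | zero =>
        have h := sum_Ico_add_sum_Icc (natExt l) (Nat.zero_le 1) (show 1 ≤ (c : ℕ) + 1 by omega)
        rw [← h, hl, sum_Icc_succ_natExt_cons]
        have := sum_Icc_natExt_le hfpos 0 hc
        simp [natExt_cons_zero]
        linarith
      | succ u =>
        rw [natExt_cons_succ, sum_Icc_succ_natExt_cons, hbelow u (by omega)]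
        exact (hlt u (by omega)).le
    · obtain ⟨u, rfl⟩ : ∃ j, m = j + 1 := ⟨m - 1, by omega⟩
      rw [natExt_cons_succ, sum_Icc_succ_natExt_cons, habove u (by omega)]
      exact hgt u (by omega) (by omega)

theorem exists_gap {n : ℕ} {T X : ℝ} {x : Fin n → ℝ} (hX : X ∈ Set.Ioo (-T) (0 : ℝ))
    (hne : ∀ i, X ≠ x i) : ∃ q : Fin (n + 1),
      natExt (Fin.cons (-T) x : Fin (n + 1) → ℝ) q < X ∧
        X < natExt (Fin.cons (-T) x : Fin (n + 1) → ℝ) (q + 1) := by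
  classical
  have hex : ∃ q, X < natExt (Fin.cons (-T) x : Fin (n + 1) → ℝ) (q + 1) :=
    ⟨n, by simpa [natExt] using hX.2⟩
  have hle : Nat.find hex ≤ n := Nat.find_min' hex (by simpa [natExt] using hX.2)
  refine ⟨⟨Nat.find hex, by omega⟩, ?_, Nat.find_spec hex⟩
  dsimp only
  cases hq : Nat.find hex with
  | zero => simpa [natExt_cons_zero] using hX.1
  | succ q =>
    refine lt_of_le_of_ne (not_lt.mp (Nat.find_min hex (by omega))) ?_
    rw [natExt_cons_succ, natExt_of_lt _ (show q < n by omega)]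
    exact (hne _).symm

theorem sum_Icc_lt_sum_Icc {n : ℕ} {f : Fin n → ℝ} (hf : ∀ i, 0 < f i) {u c c' : ℕ} (hu : u ≤ c)
    (hc : c < c') (hc' : c' < n) :
    ∑ v ∈ Finset.Icc u c, natExt f v < ∑ v ∈ Finset.Icc u c', natExt f v := by
  have hpos : ∀ v, v < n → 0 < natExt f v := fun v hv => by rw [natExt_of_lt _ hv]; exact hf _
  refine Finset.sum_lt_sum_of_subset (i := c') (Finset.Icc_subset_Icc_right hc.le)
    (by simp; omega) (by simp; omega) (hpos _ hc') fun j hj _ => (hpos j ?_).le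
  simp at hj
  omega

open Classical in
theorem ncard_hit_eq {n : ℕ} {T L : ℝ} {x : Fin n → ℝ} {g : Fin (n + 1) → ℝ} (hT : 0 < T)
    (hx : StrictMono x) (hmem : ∀ i, x i ∈ Set.Ioo (-T) 0) (hg : ∀ i, 0 < g i)
    (hsum : L + ∑ i, g i < T) (hgen : Generic x g) :
    Set.ncard {X : ℝ | X ∈ Set.Ioo (-T) (0:ℝ) ∧ (∀ i, X ≠ x i) ∧
      IsXHit (Fin.cons (-T) (Fin.snoc x X)) (Fin.cons L g) (Fin.last (n + 1))} =
    ∑ c : Fin (n + 1), ∑ q : Fin (n + 1),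
      if IsHitPosition (natExt (Fin.cons (-T) x : Fin (n + 1) → ℝ))
        (natExt (g ∘ insertPerm q)) q c then 1 else 0 := by
  have he := natExt_cons_strictMono hT hx hmem
  set e := natExt (Fin.cons (-T) x : Fin (n + 1) → ℝ) with hedef
  have hgap : ∀ {X : ℝ} {q q' : Fin (n + 1)}, e q < X → X < e (q + 1) → e q' < X →
      X < e (q' + 1) → q = q' := by
    intro X q q' h₁ h₂ h₃ h₄
    have hmono : ∀ i j, i ≤ j → j ≤ n + 1 → e i ≤ e j := fun i j hij hj =>
      hij.eq_or_lt.elim (fun h => h ▸ le_rfl) fun h => (he i j h hj).le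
    rcases lt_trichotomy (q : ℕ) q' with h | h | h
    · linarith [hmono (q + 1) q' h (by omega)]
    · exact Fin.ext h
    · linarith [hmono (q' + 1) q h (by omega)]
  let F : Finset (Fin (n + 1) × Fin (n + 1)) := Finset.univ.filter fun a =>
    IsHitPosition e (natExt (g ∘ insertPerm a.2)) a.2 a.1
  let φ : Fin (n + 1) × Fin (n + 1) → ℝ := fun a =>
    -∑ v ∈ Finset.Icc (a.2 : ℕ) a.1, natExt (g ∘ insertPerm a.2) v
  have hF : ∀ a ∈ F, e a.2 < φ a ∧ φ a < e (a.2 + 1) := fun a ha => by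
    obtain ⟨-, h₁, h₂, -⟩ := (Finset.mem_filter.mp ha).2
    exact ⟨by simp only [φ]; linarith, by simp only [φ]; linarith⟩
  have hset : {X : ℝ | X ∈ Set.Ioo (-T) (0:ℝ) ∧ (∀ i, X ≠ x i) ∧
      IsXHit (Fin.cons (-T) (Fin.snoc x X)) (Fin.cons L g) (Fin.last (n + 1))} =
      φ '' (F : Set (Fin (n + 1) × Fin (n + 1))) := by
    ext X
    constructor
    · rintro ⟨hX, hne, hhit⟩
      obtain ⟨q, h₁, h₂⟩ := exists_gap hX hne
      obtain ⟨c, hc, hcX⟩ := (isXHit_iff hT hx hmem hg hsum hgen q h₁ h₂).mp hhit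
      exact ⟨(c, q), by simpa [F] using hc, hcX⟩
    · rintro ⟨⟨c, q⟩, ha, rfl⟩
      obtain ⟨h₁, h₂⟩ := hF _ ha
      have hq : (q : ℕ) + 1 ≤ n + 1 := q.isLt
      refine ⟨⟨lt_of_le_of_lt ?_ h₁, lt_of_lt_of_le h₂ ?_⟩, fun i hi => ?_, ?_⟩
      · rw [← natExt_cons_zero (-T) x, ← hedef]
        rcases Nat.eq_zero_or_pos q with h | h
        · simp [h]
        · exact (he _ _ h (by omega)).le
      · have hend : e (n + 1) = 0 := by simp [hedef, natExt]
        rw [← hend]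
        rcases hq.eq_or_lt with h | h
        · simp [h]
        · exact (he _ _ h le_rfl).le
      · have hxi : x i = e (i + 1) := by rw [hedef, natExt_cons_succ, natExt_val]
        rw [hi, hxi] at h₁ h₂
        rcases lt_or_ge (i : ℕ) q with h | h
        · rcases (show (i : ℕ) + 1 ≤ q from h).eq_or_lt with h' | h'
          · rw [h'] at h₁; exact lt_irrefl _ h₁
          · linarith [he _ _ h' (by omega)]
        · rcases h.eq_or_lt with h' | h'
          · rw [h'] at h₂; exact lt_irrefl _ h₂
          · linarith [he (q + 1) (i + 1) (by omega) (by omega)]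
      · exact (isXHit_iff hT hx hmem hg hsum hgen q h₁ h₂).mpr
          ⟨c, (Finset.mem_filter.mp ha).2, rfl⟩
  have hinj : Set.InjOn φ (F : Set (Fin (n + 1) × Fin (n + 1))) := by
    rintro ⟨c, q⟩ ha ⟨c', q'⟩ ha' heq
    obtain ⟨h₁, h₂⟩ := hF _ ha
    obtain ⟨h₃, h₄⟩ := hF _ ha'
    rw [← heq] at h₃ h₄
    obtain rfl : q = q' := hgap h₁ h₂ h₃ h₄
    have hqc : (q : ℕ) ≤ c := (Finset.mem_filter.mp ha).2.1
    have hqc' : (q : ℕ) ≤ c' := (Finset.mem_filter.mp ha').2.1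
    have hpos : ∀ i, 0 < (g ∘ insertPerm q) i := fun i => hg _
    simp only [φ, neg_inj] at heq
    rcases lt_trichotomy (c : ℕ) c' with h | h | h
    · exact absurd heq (sum_Icc_lt_sum_Icc hpos hqc h c'.isLt).ne
    · rw [Fin.ext h]
    · exact absurd heq (sum_Icc_lt_sum_Icc hpos hqc' h c.isLt).ne'
  rw [hset, hinj.ncard_image, Set.ncard_coe_finset, Finset.card_filter,
    Fintype.sum_prod_type]

theorem sum_Icc_natExt_comp_subLeft {n : ℕ} (f : Fin (n + 1) → ℝ) {u : ℕ} (c : Fin (n + 1))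
    (h : u ≤ c) : ∑ v ∈ Finset.Icc u (c : ℕ), natExt (f ∘ Equiv.subLeft c) v =
      ∑ t ∈ Finset.Icc 0 (c - u), natExt f t := by
  have hI : Finset.Icc 0 ((c : ℕ) - u) = Finset.range (c - u + 1) := by ext; simp
  rw [hI, ← sum_Icc_reflect (natExt f) h]
  refine Finset.sum_congr rfl fun v hv => ?_
  have hvc : v ≤ c := (Finset.mem_Icc.mp hv).2
  rw [natExt_of_lt _ (show v < n + 1 by omega), natExt_of_lt _ (show (c : ℕ) - v < n + 1 by omega)]
  simp only [Function.comp_apply, Equiv.subLeft_apply]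
  congr 1
  ext
  exact Fin.sub_val_of_le (b := ⟨v, by omega⟩) hvc

open Classical in
theorem sum_isHitPosition_eq_one {n : ℕ} {T L : ℝ} {x : Fin n → ℝ} {f : Fin (n + 1) → ℝ}
    (hT : 0 < T) (hL : 0 < L) (hx : StrictMono x) (hmem : ∀ i, x i ∈ Set.Ioo (-T) 0)
    (hf : ∀ i, 0 < f i) (hsum : L + ∑ i, f i < T) (hgen : Generic x f) :
    (∑ c : Fin (n + 1), ∑ q : Fin (n + 1),
      if IsHitPosition (natExt (Fin.cons (-T) x : Fin (n + 1) → ℝ))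
        (natExt (f ∘ Equiv.subLeft c)) q c then 1 else 0) = 1 := by
  have he := natExt_cons_strictMono hT hx hmem
  set e := natExt (Fin.cons (-T) x : Fin (n + 1) → ℝ) with hedef
  let Q : ℕ → ℝ := fun t => ∑ v ∈ Finset.Icc 0 t, natExt f v
  have hiff : ∀ q c : Fin (n + 1), IsHitPosition e (natExt (f ∘ Equiv.subLeft c)) q c ↔
      ((q : ℕ) ≤ c ∧ e q + Q (c - q) < 0 ∧ 0 < e (q + 1) + Q (c - q) ∧
        (∀ u < (q : ℕ), e (u + 1) + Q (c - u) < 0) ∧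
        ∀ u, (q : ℕ) < u → u ≤ c → e u + Q (c - u) < 0) := by
    intro q c
    have hS : ∀ u ≤ (c : ℕ), ∑ v ∈ Finset.Icc u (c : ℕ), natExt (f ∘ Equiv.subLeft c) v =
        Q (c - u) := fun u hu => sum_Icc_natExt_comp_subLeft f c hu
    rw [IsHitPosition]
    refine and_congr_right fun hqc => ?_
    rw [hS q hqc]
    refine and_congr_right fun _ => and_congr_right fun _ => and_congr ?_ ?_
    · refine forall_congr' fun u => imp_congr_right fun hu => ?_
      rw [hS u (by omega)]
    · refine forall_congr' fun u => imp_congr_right fun _ => imp_congr_right fun hu => ?_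
      rw [hS u hu]
  have hex : ∃ q c, c ≤ n ∧ (q ≤ c ∧ e q + Q (c - q) < 0 ∧ 0 < e (q + 1) + Q (c - q) ∧
      (∀ u < q, e (u + 1) + Q (c - u) < 0) ∧
      ∀ u, q < u → u ≤ c → e u + Q (c - u) < 0) := by
    refine exists_hit (by simp [hedef, natExt]) ?_ (fun t ht => ?_) fun j t hj hjn ht => ?_
    · simpa [Q, natExt] using hf 0
    · have := sum_Icc_natExt_le hf 0 (show t < n + 1 by omega)
      simp only [hedef, natExt_cons_zero, Q]
      linarith
    · obtain ⟨j, rfl⟩ : ∃ i, j = i + 1 := ⟨j - 1, by omega⟩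
      rw [hedef, natExt_cons_succ]
      exact hgen.natExt_ne (by omega) 0 (by omega)
  obtain ⟨q, c, hcn, h⟩ := hex
  rw [← Fintype.sum_prod_type' (f := fun c q : Fin (n + 1) =>
    if IsHitPosition e (natExt (f ∘ Equiv.subLeft c)) q c then 1 else 0), ← Finset.card_filter,
    Finset.card_eq_one]
  refine ⟨(⟨c, by omega⟩, ⟨q, by omega⟩), ?_⟩
  ext ⟨c', q'⟩
  simp only [Finset.mem_filter, Finset.mem_univ, true_and, Finset.mem_singleton, Prod.mk.injEq,
    hiff]
  constructor
  · intro h'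
    obtain ⟨h₁, h₂⟩ := hit_unique he (Nat.lt_succ_iff.mp c'.isLt) hcn h' h
    exact ⟨Fin.ext h₂, Fin.ext h₁⟩
  · rintro ⟨rfl, rfl⟩
    exact h

theorem ae_generic (n m : ℕ) :
    ∀ᵐ xl : (Fin n → ℝ) × (Fin m → ℝ) ∂volume, Generic xl.1 xl.2 := by
  simp only [Generic, ae_all_iff]
  intro i A
  let φ : ((Fin n → ℝ) × (Fin m → ℝ)) →ₗ[ℝ] ℝ :=
    LinearMap.proj i ∘ₗ LinearMap.fst ℝ _ _ +
      (∑ a ∈ A, LinearMap.proj a) ∘ₗ LinearMap.snd ℝ _ _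
  have hφ : ∀ xl, φ xl = xl.1 i + ∑ a ∈ A, xl.2 a := fun xl => by simp [φ]
  have hker : LinearMap.ker φ ≠ ⊤ := by
    intro h
    have h' : φ (Pi.single i 1, 0) = 0 := by rw [LinearMap.ker_eq_top.mp h]; rfl
    simp [hφ] at h'
  have : (volume.prod volume : Measure ((Fin n → ℝ) × (Fin m → ℝ))).IsAddHaarMeasure :=
    Measure.prod.instIsAddHaarMeasure _ _
  rw [ae_iff, Measure.volume_eq_prod]
  convert Measure.addHaar_submodule (volume.prod volume) (LinearMap.ker φ) hker using 2
  ext xl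
  simp [hφ]

/-- **Theorem (rod placements with a blocking rod).** Let `T > L > 0`. For Lebesgue-almost
every choice of left ends `−T < x₁ < … < xₙ < 0` and positive lengths `λ₁ < … < λ_{n+1}`
with `L + λ₁ + … + λ_{n+1} < T`, the total number of locations `X ∈ (−T, 0)` producing an
`X`-hit of the origin, summed over all permutations `π` of the lengths (a rod of length `L`
placed at `−T`, the rod `λ_{π i}` placed at `x i`, and the free rod `λ_{π (last)}` placed
at `X`), equals `(n+1)!`. -/
theorem total_hit_count_eq_factorial_blocking (n : ℕ) (T L : ℝ) (hL : 0 < L) (hLT : L < T) :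
    ∀ᵐ xl : (Fin n → ℝ) × (Fin (n + 1) → ℝ) ∂volume,
      (StrictMono xl.1 ∧ (∀ i, xl.1 i ∈ Set.Ioo (-T) 0) ∧
          StrictMono xl.2 ∧ (∀ i, 0 < xl.2 i) ∧ L + ∑ i, xl.2 i < T) →
        ∑ π : Equiv.Perm (Fin (n + 1)),
            Set.ncard {X : ℝ | X ∈ Set.Ioo (-T) (0:ℝ) ∧ (∀ i, X ≠ xl.1 i) ∧
              IsXHit (Fin.cons (-T) (Fin.snoc xl.1 X)) (Fin.cons L (xl.2 ∘ π))
                (Fin.last (n + 1))} =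
          Nat.factorial (n + 1) := by
  classical
  filter_upwards [ae_generic n (n + 1)] with xl hgen
  obtain ⟨x, g⟩ := xl
  rintro ⟨hx, hmem, -, hg, hsum⟩
  dsimp only at hgen hx hmem hg hsum ⊢
  have hT := hL.trans hLT
  have hpos : ∀ σ : Equiv.Perm (Fin (n + 1)), ∀ i, 0 < (g ∘ σ) i := fun σ i => hg _
  have hsumσ : ∀ σ : Equiv.Perm (Fin (n + 1)), L + ∑ i, (g ∘ σ) i < T := fun σ => by
    simpa only [Function.comp_apply, Equiv.sum_comp σ g] using hsum
  let H : (c q : Fin (n + 1)) → Equiv.Perm (Fin (n + 1)) → ℕ := fun c q σ =>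
    if IsHitPosition (natExt (Fin.cons (-T) x : Fin (n + 1) → ℝ)) (natExt (g ∘ σ)) q c
      then 1 else 0
  calc
    _ = ∑ π : Equiv.Perm (Fin (n + 1)), ∑ c, ∑ q, H c q (π * insertPerm q) := by
      refine Finset.sum_congr rfl fun π _ => ?_
      rw [ncard_hit_eq hT hx hmem (hpos π) (hsumσ π) (hgen.comp_perm π)]
      rfl
    _ = ∑ c, ∑ q, ∑ π : Equiv.Perm (Fin (n + 1)), H c q (π * insertPerm q) := by
      rw [Finset.sum_comm]
      exact Finset.sum_congr rfl fun c _ => Finset.sum_comm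
    _ = ∑ c, ∑ q, ∑ τ : Equiv.Perm (Fin (n + 1)), H c q (τ * Equiv.subLeft c) :=
      Finset.sum_congr rfl fun c _ => Finset.sum_congr rfl fun q _ =>
        (Equiv.sum_comp (Equiv.mulRight (insertPerm q)) (H c q)).trans
          (Equiv.sum_comp (Equiv.mulRight (Equiv.subLeft c)) (H c q)).symm
    _ = ∑ τ : Equiv.Perm (Fin (n + 1)), ∑ c, ∑ q, H c q (τ * Equiv.subLeft c) := by
      rw [Finset.sum_comm (s := (Finset.univ : Finset (Equiv.Perm (Fin (n + 1)))))]
      exact Finset.sum_congr rfl fun c _ => Finset.sum_comm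
    _ = ∑ τ : Equiv.Perm (Fin (n + 1)), 1 := by
      refine Finset.sum_congr rfl fun τ _ => ?_
      refine Eq.trans ?_
        (sum_isHitPosition_eq_one hT hL hx hmem (hpos τ) (hsumσ τ) (hgen.comp_perm τ))
      rfl
    _ = Nat.factorial (n + 1) := by simp [Fintype.card_perm]
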